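/- arXiv:1003.5789 — 2 statements merged into one kernel-verified Lean document; each statement's English description precedes it below -/
import Mathlib

section
/- Let A ⊆ ℝⁿ be a compact set, let a ∈ ℝⁿ be a nonzero vector, and let t ≥ 0. Then the set of points of A at which the halfspace with inner normal a captures less than t of the measure of A itself has measure at most t: μ({x ∈ A : μ(A ∩ (x + l_a)) < t}) ≤ t. -/
open MeasureTheory
open scoped RealInnerProductSpace

/-- The closed halfspace through `x` with inner normal `a`:
`x + l_a = {y : ⟪y - x, a⟫ ≥ 0}`. -/
def halfspace {n : ℕ} (x a : EuclideanSpace ℝ (Fin n)) : Set (EuclideanSpace ℝ (Fin n)) :=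
  {y | 0 ≤ ⟪y - x, a⟫}

theorem halfspace_eq_setOf_inner_le {n : ℕ} (x a : EuclideanSpace ℝ (Fin n)) :
    halfspace x a = {y | ⟪x, a⟫ ≤ ⟪y, a⟫} := by
  ext y
  simp [halfspace, inner_sub_left]

/-- For a compact `A`, nonzero `a` and `t ≥ 0`, the set of points of `A` at which the
halfspace with inner normal `a` captures less than `t` of the measure of `A` has measure
at most `t`. -/
theorem measure_sublevel_le (n : ℕ) (hn : 1 ≤ n)
    (A : Set (EuclideanSpace ℝ (Fin n))) (hA : IsCompact A)
    (a : EuclideanSpace ℝ (Fin n)) (ha : a ≠ 0) (t : ℝ) (ht : 0 ≤ t) :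
    volume {x ∈ A | (volume (A ∩ halfspace x a)).toReal < t} ≤ ENNReal.ofReal t := by
  set S := {x ∈ A | (volume (A ∩ halfspace x a)).toReal < t}
  have le_of_mem {x} (hx : x ∈ S) : volume (A ∩ halfspace x a) ≤ ENNReal.ofReal t :=
    ENNReal.le_ofReal_iff_toReal_le
      (measure_ne_top_of_subset Set.inter_subset_left hA.measure_lt_top.ne) ht |>.2 hx.2.le
  rcases S.eq_empty_or_nonempty with hempty | hne
  · simp [hempty]
  have hbdd : BddBelow ((fun x => ⟪x, a⟫) '' S) :=
    (hA.bddBelow_image (by fun_prop)).mono (Set.image_mono (Set.sep_subset _ _))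
  by_cases hmin : ∃ x ∈ S, ∀ y ∈ S, ⟪x, a⟫ ≤ ⟪y, a⟫
  · obtain ⟨x, hx, hmin⟩ := hmin
    refine (measure_mono fun y hy => ?_).trans (le_of_mem hx)
    exact ⟨hy.1, by rw [halfspace_eq_setOf_inner_le]; exact hmin y hy⟩
  · push Not at hmin
    obtain ⟨u, hu_anti, hu_tendsto, hu_mem⟩ := exists_seq_tendsto_sInf (hne.image _) hbdd
    choose x hxS hxu using hu_mem
    have hmono : Monotone fun k => A ∩ halfspace (x k) a := by
      intro i j hij y hy
      refine ⟨hy.1, ?_⟩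
      have h := hy.2
      rw [halfspace_eq_setOf_inner_le] at h ⊢
      exact ((hxu j).trans_le ((hu_anti hij).trans_eq (hxu i).symm)).trans h
    have hcover : S ⊆ ⋃ k, A ∩ halfspace (x k) a := by
      intro y hy
      obtain ⟨z, hz, hzy⟩ := hmin y hy
      have hlt : sInf ((fun x => ⟪x, a⟫) '' S) < ⟪y, a⟫ :=
        (csInf_le hbdd (Set.mem_image_of_mem _ hz)).trans_lt hzy
      obtain ⟨k, hk⟩ := (hu_tendsto.eventually_lt_const hlt).exists
      refine Set.mem_iUnion.2 ⟨k, hy.1, ?_⟩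
      rw [halfspace_eq_setOf_inner_le]
      exact (hxu k).trans_le hk.le
    calc volume S ≤ volume (⋃ k, A ∩ halfspace (x k) a) := measure_mono hcover
      _ = ⨆ k, volume (A ∩ halfspace (x k) a) := hmono.measure_iUnion
      _ ≤ ENNReal.ofReal t := iSup_le fun k => le_of_mem (hxS k)
end

section
/- Let A ⊆ ℝⁿ be a compact set with μ(A) > 0 and let c_0, …, c_n be n+1 nonzero vectors in ℝⁿ. Then there exists a point c ∈ A such that μ(A ∩ (c + l_{c_i})) ≥ μ(A)/(n+1) for every i = 0, …, n. -/
open MeasureTheory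
open scoped RealInnerProductSpace

/-- The points `x` whose halfspace `x + l_a` meets `A` in measure less than `r`. -/
def lowDepth {n : ℕ} (A : Set (EuclideanSpace ℝ (Fin n))) (r : ENNReal)
    (a : EuclideanSpace ℝ (Fin n)) : Set (EuclideanSpace ℝ (Fin n)) :=
  {x | volume (A ∩ halfspace x a) < r}

lemma mem_halfspace_iff {n : ℕ} {x y a : EuclideanSpace ℝ (Fin n)} :
    y ∈ halfspace x a ↔ ⟪x, a⟫ ≤ ⟪y, a⟫ := by
  simp [halfspace, inner_sub_left]

lemma measure_lt_of_isCompact_subset_lowDepth {n : ℕ} {A K : Set (EuclideanSpace ℝ (Fin n))}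
    {r : ENNReal} {a : EuclideanSpace ℝ (Fin n)} (hr : 0 < r) (hK : IsCompact K)
    (hKA : K ⊆ A ∩ lowDepth A r a) : volume K < r := by
  rcases K.eq_empty_or_nonempty with rfl | hne
  · simpa using hr
  obtain ⟨p, hp, hmin⟩ := hK.exists_isMinOn hne
    (f := fun y => ⟪y, a⟫) (by fun_prop)
  have hKp : K ⊆ A ∩ halfspace p a := fun y hy => ⟨(hKA hy).1, mem_halfspace_iff.2 (hmin hy)⟩
  exact (measure_mono hKp).trans_lt (hKA hp).2

lemma isOpen_lowDepth {n : ℕ} {A : Set (EuclideanSpace ℝ (Fin n))} (hA : IsCompact A)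
    (r : ENNReal) (a : EuclideanSpace ℝ (Fin n)) : IsOpen (lowDepth A r a) := by
  rw [isOpen_iff_mem_nhds]
  intro x hx
  obtain ⟨U, hAU, hU, hUr⟩ := (A ∩ halfspace x a).exists_isOpen_lt_of_lt r hx
  have hsup : ∀ᶠ z in nhds x, ∀ y ∈ A \ U, ⟪y, a⟫ < ⟪z, a⟫ := by
    rcases (A \ U).eq_empty_or_nonempty with he | hne
    · simp [he]
    obtain ⟨m, hm, hmax⟩ := (hA.diff hU).exists_isMaxOn hne
      (f := fun y => ⟪y, a⟫) (by fun_prop)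
    have hmx : ⟪m, a⟫ < ⟪x, a⟫ := by
      by_contra! h
      exact hm.2 (hAU ⟨hm.1, mem_halfspace_iff.2 h⟩)
    have hcont : Continuous fun z : EuclideanSpace ℝ (Fin n) => ⟪z, a⟫ := by fun_prop
    filter_upwards [hcont.continuousAt.eventually_const_lt hmx] with z hz y hy
    exact (hmax hy).trans_lt hz
  filter_upwards [hsup] with z hz
  refine (measure_mono fun y hy => ?_).trans_lt hUr
  by_contra hyU
  exact (hz y ⟨hy.1, hyU⟩).not_ge (mem_halfspace_iff.1 hy.2)

lemma measure_inter_lowDepth_le {n : ℕ} {A : Set (EuclideanSpace ℝ (Fin n))} (hA : IsCompact A)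
    {r : ENNReal} (hr : 0 < r) (a : EuclideanSpace ℝ (Fin n)) :
    volume (A ∩ lowDepth A r a) ≤ r := by
  rw [(hA.measurableSet.inter (isOpen_lowDepth hA r a).measurableSet).measure_eq_iSup_isCompact]
  exact iSup₂_le fun K hKA => iSup_le fun hK =>
    (measure_lt_of_isCompact_subset_lowDepth hr hK hKA).le

/-- For compact `A` of positive measure and nonzero vectors `c₀, …, cₙ`, there is a point
`c ∈ A` with `μ(A ∩ (c + l_{cᵢ})) ≥ μ(A)/(n+1)` for all `i`. -/
theorem exists_simultaneous (n : ℕ) (hn : 1 ≤ n)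
    (A : Set (EuclideanSpace ℝ (Fin n))) (hA : IsCompact A) (hA0 : 0 < volume A)
    (c : Fin (n + 1) → EuclideanSpace ℝ (Fin n)) (hc : ∀ i, c i ≠ 0) :
    ∃ x ∈ A, ∀ i, volume A / (n + 1) ≤ volume (A ∩ halfspace x (c i)) := by
  set r : ENNReal := volume A / (n + 1)
  have hAtop : volume A ≠ ⊤ := hA.measure_lt_top.ne
  have hr : 0 < r := ENNReal.div_pos hA0.ne' (by finiteness)
  have hrtop : r ≠ ⊤ := ENNReal.div_ne_top hAtop (by simp)
  have hsum : volume A = n * r + r := by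
    rw [← add_one_mul, ENNReal.mul_div_cancel (by simp) (by finiteness)]
  by_contra! hcover
  let V := ⋃ j : Fin n, lowDepth A r (c j.succ)
  have hV : IsOpen V := isOpen_iUnion fun j => isOpen_lowDepth hA r (c j.succ)
  have hAV : volume (A ∩ V) ≤ n * r := by
    rw [Set.inter_iUnion]
    refine (measure_iUnion_fintype_le _ _).trans ?_
    simpa using Finset.sum_le_card_nsmul Finset.univ _ r
      fun j _ => measure_inter_lowDepth_le hA hr (c (Fin.succ j))
  have hlt : volume (A \ V) < r := by
    refine measure_lt_of_isCompact_subset_lowDepth (a := c 0) hr (hA.diff hV) fun x hx => ⟨hx.1, ?_⟩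
    obtain ⟨i, hi⟩ := hcover x hx.1
    cases i using Fin.cases with
    | zero => exact hi
    | succ j => exact absurd (Set.mem_iUnion.2 ⟨j, hi⟩) hx.2
  have : volume A < n * r + r := by
    rw [← measure_inter_add_sdiff A hV.measurableSet]
    exact ENNReal.add_lt_add_of_le_of_lt (measure_ne_top_of_subset Set.inter_subset_left hAtop)
      hAV hlt
  exact this.ne hsum
end
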